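/- Suppose A ⊆ ℝ is Lebesgue measurable, B ⊆ ℝ is d-open (i.e., B is Lebesgue measurable and the density of B at every point of B equals 1) and B is an Fσ set. If A + B = ℝ, then there exists a Lebesgue null set N ⊆ A such that N + B = ℝ. -/

import Mathlib

open MeasureTheory Filter Set
open scoped Pointwise ENNReal Topology

/-- The upper density of a set `B ⊆ ℝ` at a point `x`:
`limsup_{h→0⁺} |B ∩ [x−h, x+h]| / (2h)`. -/
noncomputable def upperDensity (B : Set ℝ) (x : ℝ) : ℝ≥0∞ :=
  Filter.limsup
    (fun h : ℝ => volume (B ∩ Set.Icc (x - h) (x + h)) / ENNReal.ofReal (2 * h))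
    (𝓝[>] (0 : ℝ))

/-- **Riemann–Lebesgue lemma** for the cosine on a set of finite measure. -/
lemma tendsto_setIntegral_cos_mul {S : Set ℝ} (hS : MeasurableSet S) (hfin : volume S ≠ ∞) :
    Tendsto (fun w : ℝ => ∫ t in S, Real.cos (w * t)) atTop (𝓝 0) := by
  have key := (Real.tendsto_integral_exp_smul_cocompact (S.indicator fun _ => (1 : ℂ))).comp
    ((tendsto_id.atTop_div_const Real.two_pi_pos).mono_right atTop_le_cocompact)
  have hre := (Complex.continuous_re.tendsto 0).comp key
  simp only [Complex.zero_re] at hre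
  refine hre.congr fun w => ?_
  have hint : Integrable (S.indicator fun _ => (1 : ℂ)) :=
    (integrable_indicator_iff hS).2 (integrableOn_const hfin)
  have hint' := (Real.fourierIntegral_convergent_iff (w / (2 * Real.pi))).2 hint
  have hint'' : Integrable fun v : ℝ =>
      Real.fourierChar (-(v * (w / (2 * Real.pi)))) • S.indicator (fun _ => (1 : ℂ)) v := by
    refine hint'.congr (Eventually.of_forall fun v => ?_)
    simp [mul_comm]
  simp only [Function.comp_apply, id]
  rw [← integral_indicator hS]
  refine ((integral_re hint'').symm.trans (integral_congr_ae (Eventually.of_forall fun v => ?_)))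
  by_cases hv : v ∈ S
  · simp only [hv, indicator_of_mem, Circle.smul_def, Real.fourierChar_apply, smul_eq_mul, mul_one,
      RCLike.re_to_complex, Complex.exp_ofReal_mul_I_re]
    rw [← Real.cos_neg]
    congr 1
    field_simp
  · simp [hv]

/-- If the sets `E w` dominate the functions `(a cos (w t) + cos² (w t)) / 2`, then for large `w`
they meet `S` in at least an eighth of its measure. -/
lemma eventually_measureReal_inter_ge {S : Set ℝ} (hS : MeasurableSet S) (hfin : volume S ≠ ∞)
    (hpos : volume S ≠ 0) {E : ℝ → Set ℝ} (hE : ∀ w, MeasurableSet (E w)) (a : ℝ)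
    (ha : ∀ w t, (a * Real.cos (w * t) + Real.cos (w * t) ^ 2) / 2 ≤ (E w).indicator 1 t) :
    ∀ᶠ w in atTop, volume.real S / 8 < volume.real (S ∩ E w) := by
  have hcos (w : ℝ) : IntegrableOn (fun t => Real.cos (w * t)) S :=
    Measure.integrableOn_of_bounded (M := 1) hfin (by fun_prop)
      (Eventually.of_forall fun t => Real.abs_cos_le_one _)
  have h1 := tendsto_setIntegral_cos_mul hS hfin
  have h2 := h1.comp (tendsto_id.const_mul_atTop (zero_lt_two' ℝ))
  have hlim := ((h1.const_mul (a / 2)).add (h2.const_mul (1 / 4))).add_const (volume.real S / 4)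
  have hS0 : 0 < volume.real S := ENNReal.toReal_pos hpos hfin
  filter_upwards [hlim.eventually_const_lt (u := volume.real S / 8) (by linarith)] with w hw
  refine hw.trans_le ?_
  have hint (w : ℝ) :
      IntegrableOn (fun t => a / 2 * Real.cos (w * t) + 1 / 4 * Real.cos (2 * w * t)) S :=
    ((hcos w).const_mul _).add ((hcos (2 * w)).const_mul _)
  have hone : IntegrableOn (fun _ => (1 / 4 : ℝ)) S := integrableOn_const hfin
  calc _ = ∫ t in S, (a / 2 * Real.cos (w * t) + 1 / 4 * Real.cos (2 * w * t) + 1 / 4) := by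
        rw [integral_add (hint w) hone,
          integral_add ((hcos w).const_mul _) ((hcos (2 * w)).const_mul _),
          integral_const_mul, integral_const_mul]
        simp
        ring
    _ ≤ ∫ t in S, (E w).indicator 1 t := by
        refine setIntegral_mono ((hint w).add hone) ?_ fun t => ?_
        · exact IntegrableOn.indicator (integrableOn_const hfin) (hE w)
        · refine le_trans (le_of_eq ?_) (ha w t)
          rw [mul_assoc 2 w t, Real.cos_two_mul]
          ring
    _ = volume.real (S ∩ E w) := by
        rw [integral_indicator_one (hE w), measureReal_restrict_apply (hE w), inter_comm]

lemma eventually_measureReal_inter_cos_nonneg {S : Set ℝ} (hS : MeasurableSet S)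
    (hfin : volume S ≠ ∞) (hpos : volume S ≠ 0) :
    ∀ᶠ w : ℝ in atTop, volume.real S / 8 < volume.real (S ∩ {t | 0 ≤ Real.cos (w * t)}) := by
  refine eventually_measureReal_inter_ge hS hfin hpos
    (fun w => measurableSet_le (by fun_prop) (by fun_prop)) 1 fun w t => ?_
  have h1 := Real.neg_one_le_cos (w * t)
  have h2 := Real.cos_le_one (w * t)
  by_cases h : 0 ≤ Real.cos (w * t)
  · simp only [indicator, mem_ofPred_eq, h, if_true, Pi.one_apply]
    nlinarith
  · simp only [indicator, mem_ofPred_eq, h, if_false]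
    nlinarith

lemma eventually_measureReal_inter_cos_neg {S : Set ℝ} (hS : MeasurableSet S)
    (hfin : volume S ≠ ∞) (hpos : volume S ≠ 0) :
    ∀ᶠ w : ℝ in atTop, volume.real S / 8 < volume.real (S ∩ {t | Real.cos (w * t) < 0}) := by
  refine eventually_measureReal_inter_ge hS hfin hpos
    (fun w => measurableSet_lt (by fun_prop) (by fun_prop)) (-1) fun w t => ?_
  have h1 := Real.neg_one_le_cos (w * t)
  have h2 := Real.cos_le_one (w * t)
  by_cases h : Real.cos (w * t) < 0
  · simp only [indicator, mem_ofPred_eq, h, if_true, Pi.one_apply]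
    nlinarith
  · simp only [indicator, mem_ofPred_eq, h, if_false]
    nlinarith

/-- Continuity of translation in measure, based at an arbitrary point. -/
lemma eventually_measure_vadd_sdiff_vadd_lt {F : Set ℝ} (hF : IsCompact F) {ε : ℝ≥0∞}
    (hε : ε ≠ 0) (x₀ : ℝ) : ∀ᶠ x in 𝓝 x₀, volume ((x₀ +ᵥ F) \ (x +ᵥ F)) < ε := by
  have h0 : Tendsto (fun x => x₀ - x) (𝓝 x₀) (𝓝 0) :=
    (Continuous.tendsto' (by fun_prop) _ _ (sub_self x₀))
  filter_upwards [h0.eventually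
    (eventually_nhds_zero_measure_vadd_sdiff_lt (μ := volume) hF hF.isClosed hε)] with x hx
  rwa [← measure_vadd volume x, vadd_set_sdiff, vadd_vadd, add_sub_cancel] at hx

/-- A compact set meeting each translate `x + F`, `x ∈ C`, in positive measure can be shrunk by a
fixed factor while keeping this property. -/
lemma exists_isCompact_subset_measureReal_le {K F C : Set ℝ} (hK : IsCompact K) (hF : IsCompact F)
    (hC : IsCompact C) (h : ∀ x ∈ C, volume (K ∩ (x +ᵥ F)) ≠ 0) :
    ∃ K' ⊆ K, IsCompact K' ∧ volume.real K' ≤ 7 / 8 * volume.real K ∧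
      ∀ x ∈ C, volume (K' ∩ (x +ᵥ F)) ≠ 0 := by
  by_cases hK0 : volume K = 0
  · exact ⟨K, Subset.rfl, hK, by simp [measureReal_def, hK0], h⟩
  have hloc : ∀ x₀ ∈ C, ∀ᶠ p : ℝ × ℝ in atTop ×ˢ 𝓝 x₀,
      volume ((K ∩ {t | 0 ≤ Real.cos (p.1 * t)}) ∩ (p.2 +ᵥ F)) ≠ 0 := by
    intro x₀ hx₀
    set S := K ∩ (x₀ +ᵥ F)
    have hSc : IsCompact S := hK.inter_right (hF.vadd x₀).isClosed
    have hSpos := h x₀ hx₀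
    have hSfin : volume S ≠ ∞ := hSc.measure_lt_top.ne
    have hε : volume S / 8 ≠ 0 := ENNReal.div_ne_zero.2 ⟨hSpos, by simp⟩
    filter_upwards [(eventually_measureReal_inter_cos_nonneg hSc.measurableSet hSfin hSpos).prod_mk
      (eventually_measure_vadd_sdiff_vadd_lt hF hε x₀)] with ⟨w, x⟩ ⟨hw, hx⟩ h0
    simp only at hw hx h0
    have hw' : volume S / 8 < volume (S ∩ {t | 0 ≤ Real.cos (w * t)}) := by
      rw [← ENNReal.toReal_lt_toReal (ENNReal.div_ne_top hSfin (by simp))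
        (measure_ne_top_of_subset inter_subset_left hSfin)]
      simpa [measureReal_def, ENNReal.toReal_div] using hw
    refine (hw'.trans_le ?_).not_gt hx
    have hsub : S ∩ {t | 0 ≤ Real.cos (w * t)} ⊆
        ((K ∩ {t | 0 ≤ Real.cos (w * t)}) ∩ (x +ᵥ F)) ∪ ((x₀ +ᵥ F) \ (x +ᵥ F)) := by
      intro t ht
      by_cases htx : t ∈ x +ᵥ F
      · exact Or.inl ⟨⟨ht.1.1, ht.2⟩, htx⟩
      · exact Or.inr ⟨ht.1.2, htx⟩
    refine (measure_mono hsub).trans ((measure_union_le _ _).trans ?_)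
    rw [h0, zero_add]
  have hglob : ∀ᶠ w : ℝ in atTop, ∀ x ∈ C,
      volume ((K ∩ {t | 0 ≤ Real.cos (w * t)}) ∩ (x +ᵥ F)) ≠ 0 := by
    have hprod : ∀ᶠ p : ℝ × ℝ in atTop ×ˢ 𝓝ˢ C,
        volume ((K ∩ {t | 0 ≤ Real.cos (p.1 * t)}) ∩ (p.2 +ᵥ F)) ≠ 0 :=
      hC.mem_prod_nhdsSet_of_forall hloc
    exact hprod.curry.mono fun w hw x hx => hw.self_of_nhdsSet x hx
  obtain ⟨w, hw, hneg⟩ := (hglob.and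
    (eventually_measureReal_inter_cos_neg hK.measurableSet hK.measure_lt_top.ne hK0)).exists
  refine ⟨_, inter_subset_left,
    hK.inter_right (isClosed_le continuous_const (by fun_prop)), ?_, hw⟩
  have hsplit := measureReal_inter_add_sdiff (μ := volume) (s := K)
    (measurableSet_le measurable_const (by fun_prop) : MeasurableSet {t | 0 ≤ Real.cos (w * t)})
    hK.measure_lt_top.ne
  have hdiff : K \ {t | 0 ≤ Real.cos (w * t)} = K ∩ {t | Real.cos (w * t) < 0} := by
    ext t
    simp
  rw [hdiff] at hsplit
  linarith

/-- A compact set meeting each translate `x + F`, `x ∈ C`, in positive measure has a null subset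
still meeting all of them. -/
lemma exists_null_subset_inter_vadd_nonempty {K F C : Set ℝ} (hK : IsCompact K)
    (hF : IsCompact F) (hC : IsCompact C) (h : ∀ x ∈ C, volume (K ∩ (x +ᵥ F)) ≠ 0) :
    ∃ N ⊆ K, volume N = 0 ∧ ∀ x ∈ C, (N ∩ (x +ᵥ F)).Nonempty := by
  let T := {L : Set ℝ // IsCompact L ∧ ∀ x ∈ C, volume (L ∩ (x +ᵥ F)) ≠ 0}
  have hstep : ∀ L : T, ∃ L' : T, L'.1 ⊆ L.1 ∧ volume.real L'.1 ≤ 7 / 8 * volume.real L.1 := by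
    rintro ⟨L, hL, hLC⟩
    obtain ⟨L', hsub, hL', hle, hL'C⟩ := exists_isCompact_subset_measureReal_le hL hF hC hLC
    exact ⟨⟨L', hL', hL'C⟩, hsub, hle⟩
  choose next hsub hle using hstep
  let u : ℕ → T := fun n => next^[n] ⟨K, hK, h⟩
  have hu (n : ℕ) : u (n + 1) = next (u n) := Function.iterate_succ_apply' _ _ _
  have hbound (n : ℕ) : volume.real (u n).1 ≤ (7 / 8) ^ n * volume.real K := by
    induction n with
    | zero => simp [u]
    | succ n ih =>
      rw [hu, pow_succ']
      linarith [hle (u n)]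
  refine ⟨⋂ n, (u n).1, iInter_subset _ 0, ?_, fun x hx => ?_⟩
  · have hreal : volume.real (⋂ n, (u n).1) ≤ 0 := by
      have hlim : Tendsto (fun n : ℕ => (7 / 8 : ℝ) ^ n * volume.real K) atTop (𝓝 0) := by
        simpa using (tendsto_pow_atTop_nhds_zero_of_lt_one (r := (7 / 8 : ℝ)) (by norm_num)
          (by norm_num)).mul_const (volume.real K)
      exact ge_of_tendsto' hlim fun n =>
        (measureReal_mono (iInter_subset _ n) (u n).2.1.measure_lt_top.ne).trans (hbound n)
    exact (measureReal_eq_zero_iff (measure_ne_top_of_subset (iInter_subset _ 0)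
      (u 0).2.1.measure_lt_top.ne)).1 (hreal.antisymm measureReal_nonneg)
  · have hc (n : ℕ) : IsCompact ((u n).1 ∩ (x +ᵥ F)) :=
      (u n).2.1.inter_right (hF.vadd x).isClosed
    rw [iInter_inter]
    refine IsCompact.nonempty_iInter_of_sequence_nonempty_isCompact_isClosed _ (fun n => ?_)
      (fun n => nonempty_of_measure_ne_zero ((u n).2.2 x hx)) (hc 0) fun n => (hc n).isClosed
    rw [hu]
    exact inter_subset_inter_left _ (hsub _)

/-- A compact set `K` of positive measure has a null subset `N` such that `N - K` is a
neighborhood of `0`, a strengthening of the Steinhaus theorem. -/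
lemma exists_null_subset_sub_mem_nhds_zero {K : Set ℝ} (hK : IsCompact K) (hpos : volume K ≠ 0) :
    ∃ N ⊆ K, volume N = 0 ∧ N - K ∈ 𝓝 (0 : ℝ) := by
  have hev : ∀ᶠ x in 𝓝 (0 : ℝ), volume (K ∩ (x +ᵥ K)) ≠ 0 := by
    filter_upwards [eventually_measure_vadd_sdiff_vadd_lt hK hpos 0] with x hx h0
    rw [zero_vadd] at hx
    exact hx.not_ge ((measure_le_inter_add_sdiff volume K (x +ᵥ K)).trans (by rw [h0, zero_add]))
  obtain ⟨C, hC0, hCsub, hC⟩ := local_compact_nhds hev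
  obtain ⟨N, hNK, hN0, hN⟩ := exists_null_subset_inter_vadd_nonempty hK hK hC hCsub
  refine ⟨N, hNK, hN0, mem_of_superset hC0 fun x hx => ?_⟩
  obtain ⟨n, hnN, k, hk, rfl⟩ := hN x hx
  exact ⟨_, hnN, k, hk, by simp⟩

/-- If `A ∩ (x - B)` is not null, then `A` has a null subset `N` such that `N + B` is a neighborhood
of `x`. -/
lemma exists_null_subset_add_mem_nhds {A B : Set ℝ} (hA : MeasurableSet A) (hB : MeasurableSet B)
    {x : ℝ} (hx : volume (A ∩ {a | x - a ∈ B}) ≠ 0) :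
    ∃ N ⊆ A, volume N = 0 ∧ N + B ∈ 𝓝 x := by
  obtain ⟨K, hKsub, hK, hKpos⟩ := (hA.inter (hB.preimage (measurable_id.const_sub x) :
    MeasurableSet {a | x - a ∈ B})).exists_lt_isCompact (pos_iff_ne_zero.2 hx)
  obtain ⟨N, hNK, hN0, hN⟩ := exists_null_subset_sub_mem_nhds_zero hK hKpos.ne'
  refine ⟨N, fun n hn => (hKsub (hNK hn)).1, hN0, ?_⟩
  have ht : Tendsto (fun y => y - x) (𝓝 x) (𝓝 0) :=
    Continuous.tendsto' (by fun_prop) _ _ (sub_self x)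
  filter_upwards [ht hN] with y hy
  obtain ⟨n, hn, k, hk, hnk⟩ := hy
  exact ⟨n, hn, x - k, (hKsub hk).2, by simp only at hnk ⊢; linarith⟩

/-- If both `A` has density one at `a` and `B` has density one at `b`, then `A ∩ (a + b - B)` is not
null. -/
lemma measure_inter_ne_zero_of_density_one {A B : Set ℝ} (hA : MeasurableSet A) {a b : ℝ}
    (ha : Tendsto (fun h : ℝ => volume (A ∩ Icc (a - h) (a + h)) / ENNReal.ofReal (2 * h))
      (𝓝[>] 0) (𝓝 1))
    (hb : Tendsto (fun h : ℝ => volume (B ∩ Icc (b - h) (b + h)) / ENNReal.ofReal (2 * h))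
      (𝓝[>] 0) (𝓝 1)) :
    volume (A ∩ {t | a + b - t ∈ B}) ≠ 0 := by
  intro h0
  refine absurd (le_of_tendsto (ha.add hb) (b := 1) ?_) (by norm_num)
  filter_upwards [self_mem_nhdsWithin] with h hh
  have hrefl : volume (B ∩ Icc (b - h) (b + h)) =
      volume ({t | a + b - t ∈ B} ∩ Icc (a - h) (a + h)) := by
    rw [← (Measure.measurePreserving_sub_left volume (a + b)).measure_preimage_equiv
      (f := MeasurableEquiv.subLeft (a + b))]
    congr 1
    ext t
    change a + b - t ∈ B ∧ (b - h ≤ a + b - t ∧ a + b - t ≤ b + h) ↔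
      a + b - t ∈ B ∧ (a - h ≤ t ∧ t ≤ a + h)
    refine and_congr_right fun _ => ⟨fun H => ⟨?_, ?_⟩, fun H => ⟨?_, ?_⟩⟩ <;> linarith [H.1, H.2]
  rw [hrefl, ENNReal.div_add_div_same]
  refine ENNReal.div_le_of_le_mul ?_
  rw [one_mul, ← measure_union_add_inter₀' (hA.inter measurableSet_Icc).nullMeasurableSet]
  have hnull : volume (A ∩ Icc (a - h) (a + h) ∩
      ({t | a + b - t ∈ B} ∩ Icc (a - h) (a + h))) = 0 :=
    measure_mono_null (inter_subset_inter inter_subset_left inter_subset_left) h0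
  rw [hnull, add_zero]
  refine (measure_mono (union_subset inter_subset_right inter_subset_right)).trans ?_
  rw [Real.volume_Icc]
  exact ENNReal.ofReal_le_ofReal (by linarith)

theorem stmt_8 (A B : Set ℝ) (hA : MeasurableSet A) (hB : MeasurableSet B)
    (hdopen : ∀ x ∈ B, Filter.Tendsto
      (fun h : ℝ => volume (B ∩ Set.Icc (x - h) (x + h)) / ENNReal.ofReal (2 * h))
      (𝓝[>] (0 : ℝ)) (𝓝 1))
    (hBFσ : ∃ f : ℕ → Set ℝ, (∀ n, IsClosed (f n)) ∧ B = ⋃ n, f n)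
    (hAB : A + B = Set.univ) :
    ∃ N, N ⊆ A ∧ volume N = 0 ∧ N + B = Set.univ := by
  let P : ℝ → Prop := fun a => Tendsto
    (fun h : ℝ => volume (A ∩ Icc (a - h) (a + h)) / ENNReal.ofReal (2 * h)) (𝓝[>] 0) (𝓝 1)
  have hZ : volume {a | a ∈ A ∧ ¬ P a} = 0 := by
    have hae := (ae_restrict_iff' hA).1 (Besicovitch.ae_tendsto_measure_inter_div volume A)
    refine measure_mono_null (fun a ha => ?_) (ae_iff.1 hae)
    simpa [P, Real.closedBall_eq_Icc, two_mul] using ha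
  let U := {x : ℝ | volume (A ∩ {a | x - a ∈ B}) ≠ 0}
  have hloc : ∀ x : ℝ, ∃ N ⊆ A, volume N = 0 ∧ (x ∈ U → N + B ∈ 𝓝 x) := by
    intro x
    by_cases hx : x ∈ U
    · obtain ⟨N, h1, h2, h3⟩ := exists_null_subset_add_mem_nhds hA hB hx
      exact ⟨N, h1, h2, fun _ => h3⟩
    · exact ⟨∅, empty_subset _, measure_empty, fun h => absurd h hx⟩
  choose M hMA hM0 hMU using hloc
  obtain ⟨t, -, htc, hUt⟩ := TopologicalSpace.countable_cover_nhdsWithin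
    (f := fun x => M x + B) fun x hx => mem_nhdsWithin_of_mem_nhds (hMU x hx)
  refine ⟨{a | a ∈ A ∧ ¬ P a} ∪ ⋃ x ∈ t, M x,
    union_subset (fun a ha => ha.1) (iUnion₂_subset fun x _ => hMA x),
    measure_union_null hZ ((measure_biUnion_null_iff htc).2 fun x _ => hM0 x),
    eq_univ_of_forall fun x => ?_⟩
  by_cases hx : x ∈ U
  · obtain ⟨y, hy, hxy⟩ := mem_iUnion₂.1 (hUt hx)
    exact add_subset_add_right ((subset_biUnion_of_mem hy).trans subset_union_right) hxy
  · obtain ⟨a, ha, b, hb, rfl⟩ : x ∈ A + B := hAB ▸ mem_univ x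
    refine ⟨a, Or.inl ⟨ha, fun hP => hx ?_⟩, b, hb, rfl⟩
    exact measure_inter_ne_zero_of_density_one hA hP (hdopen b hb)
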